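/- arXiv:2507.04448 — 4 statements merged into one kernel-verified Lean document; each statement's English description precedes it below -/
import Mathlib

section
/- Let P be a positive integer, β > 0, γ₀ ≠ 0, let Φ ∈ ℝ^{P×P} be symmetric positive semidefinite, y ∈ ℝ^P, and suppose f, f̂ ∈ ℝ^P satisfy γ₀ f̂ = β γ₀² (f − y) and γ₀ f + Φ f̂ = 0. If moreover Φ₀ ∈ ℝ^P and f₀ ∈ ℝ satisfy γ₀ f₀ + Φ₀ᵀ f̂ = 0, then f₀ = Φ₀ᵀ (Φ + β⁻¹ I)⁻¹ y; in particular, for any y₀ ∈ ℝ the squared test error equals (y₀ − f₀)² = (y₀ − Φ₀ᵀ (Φ + β⁻¹ I)⁻¹ y)². -/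
open Matrix

/-- After transfer learning, the test prediction of the Bayesian two-layer network is
a kernel regression prediction with the adapted kernel. -/
theorem stmt1 (P : ℕ) (hP : 0 < P) (β γ₀ : ℝ) (hβ : 0 < β) (hγ : γ₀ ≠ 0)
    (Φ : Matrix (Fin P) (Fin P) ℝ) (hΦ : Φ.PosSemidef)
    (y f fhat : Fin P → ℝ)
    (h1 : γ₀ • fhat = (β * γ₀ ^ 2) • (f - y))
    (h2 : γ₀ • f + Φ *ᵥ fhat = 0)
    (Φ₀ : Fin P → ℝ) (f₀ : ℝ)
    (h3 : γ₀ * f₀ + Φ₀ ⬝ᵥ fhat = 0) :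
    f₀ = Φ₀ ⬝ᵥ ((Φ + β⁻¹ • (1 : Matrix (Fin P) (Fin P) ℝ))⁻¹ *ᵥ y) ∧
    ∀ y₀ : ℝ, (y₀ - f₀) ^ 2 =
      (y₀ - Φ₀ ⬝ᵥ ((Φ + β⁻¹ • (1 : Matrix (Fin P) (Fin P) ℝ))⁻¹ *ᵥ y)) ^ 2 := by
  suffices h : f₀ = Φ₀ ⬝ᵥ ((Φ + β⁻¹ • (1 : Matrix (Fin P) (Fin P) ℝ))⁻¹ *ᵥ y) from
    ⟨h, fun y₀ => by rw [← h]⟩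
  have hA : (Φ + β⁻¹ • (1 : Matrix (Fin P) (Fin P) ℝ)).PosDef :=
    PosDef.posSemidef_add hΦ (PosDef.one.smul (inv_pos.mpr hβ))
  have hlin : (Φ + β⁻¹ • (1 : Matrix (Fin P) (Fin P) ℝ)) *ᵥ fhat = -γ₀ • y := by
    ext i
    have e1 := congrFun h1 i
    have e2 := congrFun h2 i
    simp only [Pi.smul_apply, Pi.sub_apply, Pi.add_apply, Pi.zero_apply, smul_eq_mul,
      add_mulVec, smul_mulVec, one_mulVec] at e1 e2 ⊢
    have e3 : fhat i = β * γ₀ * (f i - y i) := mul_left_cancel₀ hγ (by linear_combination e1)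
    have hβ' : β⁻¹ * β = 1 := inv_mul_cancel₀ hβ.ne'
    linear_combination e2 + β⁻¹ * e3 + γ₀ * (f i - y i) * hβ'
  have hfhat : fhat = -γ₀ • ((Φ + β⁻¹ • (1 : Matrix (Fin P) (Fin P) ℝ))⁻¹ *ᵥ y) := by
    rw [← mulVec_smul, ← hlin, mulVec_mulVec,
      nonsing_inv_mul _ ((isUnit_iff_isUnit_det _).mp hA.isUnit), one_mulVec]
  rw [hfhat, dotProduct_smul, smul_eq_mul] at h3
  exact mul_left_cancel₀ hγ (by linear_combination h3)
end

section
/- Let P be a positive integer, let C ∈ ℝ^{P×P} be symmetric positive definite, let Φ̂ ∈ ℝ^{P×P} be symmetric, and let δ ≥ 0 be such that M := (1+δ) C⁻¹ + Φ̂ is positive definite. Let h̄ be a random vector in ℝ^P with E‖h̄‖² < ∞ and second-moment matrix S = E[h̄ h̄ᵀ]. For each realization of h̄, let μ_{h̄} be the probability measure on ℝ^P with density proportional to exp(−((1+δ)/2) (h − (δ/(1+δ)) h̄)ᵀ C⁻¹ (h − (δ/(1+δ)) h̄) − ½ hᵀ Φ̂ h). Then E_{h̄}[ ∫ h hᵀ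 dμ_{h̄}(h) ] = M⁻¹ + δ² M⁻¹ C⁻¹ S C⁻¹ M⁻¹. -/
open Matrix MeasureTheory

open ProbabilityTheory in
theorem integrable_gaussianPDFReal_mul_pow (n : ℕ) :
    Integrable (fun x : ℝ => gaussianPDFReal 0 1 x * x ^ n) := by
  have h : Integrable (fun x : ℝ => x ^ n) (gaussianReal 0 1) := by
    have := (memLp_id_gaussianReal' (μ := 0) (v := 1) n (by simp)).integrable_norm_pow'
    refine (integrable_norm_iff (by fun_prop)).1 ?_
    simpa using this
  rw [gaussianReal_of_var_ne_zero 0 one_ne_zero,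
    integrable_withDensity_iff_integrable_smul' (measurable_gaussianPDF 0 1)
      (ae_of_all _ fun _ => gaussianPDF_lt_top)] at h
  simpa using h

open ProbabilityTheory in
theorem integral_gaussianPDFReal_mul_self : ∫ x : ℝ, gaussianPDFReal 0 1 x * x = 0 := by
  have := integral_gaussianReal_eq_integral_smul (μ := 0) (f := fun x : ℝ => x)
    (one_ne_zero (α := NNReal))
  simpa using this.symm

open ProbabilityTheory in
theorem integral_gaussianPDFReal_mul_sq : ∫ x : ℝ, gaussianPDFReal 0 1 x * x ^ 2 = 1 := by
  have h := integral_gaussianReal_eq_integral_smul (μ := 0) (f := fun x : ℝ => x ^ 2)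
    (one_ne_zero (α := NNReal))
  have hv := variance_fun_id_gaussianReal (μ := 0) (v := 1)
  rw [variance_eq_integral measurable_id'.aemeasurable] at hv
  simp only [integral_id_gaussianReal, sub_zero] at hv
  simpa [hv] using h.symm

section StandardGaussian

variable {ι : Type*} [Fintype ι]

/-- The density of the standard Gaussian measure on `ι → ℝ`. -/
noncomputable def stdGaussianPDF (x : ι → ℝ) : ℝ :=
  ∏ a, ProbabilityTheory.gaussianPDFReal 0 1 (x a)

theorem exists_stdGaussianPDF_eq_mul_exp :
    ∃ c : ℝ, 0 < c ∧ ∀ x : ι → ℝ, stdGaussianPDF x = c * Real.exp (-(1 / 2) * (x ⬝ᵥ x)) := by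
  refine ⟨∏ _a : ι, (√(2 * Real.pi * (1 : NNReal)))⁻¹, by positivity, fun x => ?_⟩
  simp only [stdGaussianPDF, ProbabilityTheory.gaussianPDFReal, Finset.prod_mul_distrib,
    ← Real.exp_sum, dotProduct, Finset.mul_sum]
  congr 3 with a
  simp
  ring

theorem integrable_stdGaussianPDF : Integrable (stdGaussianPDF (ι := ι)) :=
  Integrable.fintype_prod fun _ => ProbabilityTheory.integrable_gaussianPDFReal 0 1

theorem integral_stdGaussianPDF : ∫ x : ι → ℝ, stdGaussianPDF x = 1 := by
  unfold stdGaussianPDF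
  rw [integral_fintype_prod_volume_eq_pow]
  simp [ProbabilityTheory.integral_gaussianPDFReal_eq_one]

variable [DecidableEq ι]

theorem stdGaussianPDF_mul_pow (k l : ι) (m n : ℕ) (x : ι → ℝ) :
    stdGaussianPDF x * (x k ^ m * x l ^ n) =
      ∏ a, ProbabilityTheory.gaussianPDFReal 0 1 (x a) *
        x a ^ ((if a = k then m else 0) + (if a = l then n else 0)) := by
  simp only [stdGaussianPDF, Finset.prod_mul_distrib, pow_add]
  simp [pow_ite]

theorem integrable_stdGaussianPDF_mul_pow (k l : ι) (m n : ℕ) :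
    Integrable fun x : ι → ℝ => stdGaussianPDF x * (x k ^ m * x l ^ n) := by
  simp only [stdGaussianPDF_mul_pow]
  exact Integrable.fintype_prod (f := fun a y => ProbabilityTheory.gaussianPDFReal 0 1 y *
    y ^ ((if a = k then m else 0) + (if a = l then n else 0)))
    fun _ => integrable_gaussianPDFReal_mul_pow _

theorem integral_stdGaussianPDF_mul_pow (k l : ι) (m n : ℕ) :
    ∫ x : ι → ℝ, stdGaussianPDF x * (x k ^ m * x l ^ n) =
      ∏ a, ∫ y, ProbabilityTheory.gaussianPDFReal 0 1 y *
        y ^ ((if a = k then m else 0) + (if a = l then n else 0)) := by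
  simp only [stdGaussianPDF_mul_pow]
  exact integral_fintype_prod_volume_eq_prod (fun a y => ProbabilityTheory.gaussianPDFReal 0 1 y *
    y ^ ((if a = k then m else 0) + (if a = l then n else 0)))

theorem integrable_stdGaussianPDF_mul_apply (k : ι) :
    Integrable fun x : ι → ℝ => stdGaussianPDF x * x k := by
  simpa using integrable_stdGaussianPDF_mul_pow k k 1 0

theorem integral_stdGaussianPDF_mul_apply (k : ι) :
    ∫ x : ι → ℝ, stdGaussianPDF x * x k = 0 := by
  have h := integral_stdGaussianPDF_mul_pow k k 1 0
  simp only [pow_one, pow_zero, mul_one] at h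
  rw [h]
  exact Finset.prod_eq_zero (Finset.mem_univ k) (by simp [integral_gaussianPDFReal_mul_self])

theorem integrable_stdGaussianPDF_mul_apply_mul_apply (k l : ι) :
    Integrable fun x : ι → ℝ => stdGaussianPDF x * (x k * x l) := by
  simpa using integrable_stdGaussianPDF_mul_pow k l 1 1

theorem integral_stdGaussianPDF_mul_apply_mul_apply (k l : ι) :
    ∫ x : ι → ℝ, stdGaussianPDF x * (x k * x l) = (1 : Matrix ι ι ℝ) k l := by
  have h := integral_stdGaussianPDF_mul_pow k l 1 1
  simp only [pow_one] at h
  rw [h]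
  rcases eq_or_ne k l with rfl | hkl
  · rw [one_apply_eq]
    refine Finset.prod_eq_one fun a _ => ?_
    by_cases ha : a = k
    · simp [ha, integral_gaussianPDFReal_mul_sq]
    · simp [ha, ProbabilityTheory.integral_gaussianPDFReal_eq_one]
  · rw [one_apply_ne hkl]
    exact Finset.prod_eq_zero (Finset.mem_univ k)
      (by simp [hkl, integral_gaussianPDFReal_mul_self])

theorem integral_stdGaussianPDF_mul_affine_mul_affine (B : Matrix ι ι ℝ) (m : ι → ℝ) (i j : ι) :
    ∫ x : ι → ℝ, stdGaussianPDF x * ((m + B *ᵥ x) i * (m + B *ᵥ x) j) =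
      (B * Bᵀ) i j + m i * m j := by
  have expand : ∀ x : ι → ℝ, stdGaussianPDF x * ((m + B *ᵥ x) i * (m + B *ᵥ x) j) =
      stdGaussianPDF x * (m i * m j) + (∑ k, stdGaussianPDF x * x k * (m j * B i k + m i * B j k) +
        ∑ k, ∑ l, stdGaussianPDF x * (x k * x l) * (B i k * B j l)) := fun x => by
    have h₁ : ∑ k, stdGaussianPDF x * x k * (m j * B i k + m i * B j k) =
        stdGaussianPDF x * (m j * (B *ᵥ x) i + m i * (B *ᵥ x) j) := by
      simp only [mulVec, dotProduct, Finset.mul_sum, ← Finset.sum_add_distrib]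
      exact Finset.sum_congr rfl fun k _ => by ring
    have h₂ : ∑ k, ∑ l, stdGaussianPDF x * (x k * x l) * (B i k * B j l) =
        stdGaussianPDF x * ((B *ᵥ x) i * (B *ᵥ x) j) := by
      simp only [mulVec, dotProduct]
      rw [Finset.sum_mul_sum]
      simp only [Finset.mul_sum]
      exact Finset.sum_congr rfl fun k _ => Finset.sum_congr rfl fun l _ => by ring
    rw [h₁, h₂]
    simp only [Pi.add_apply]
    ring
  have i₀ := (integrable_stdGaussianPDF (ι := ι)).mul_const (m i * m j)
  have i₁ : ∀ k ∈ Finset.univ, Integrable fun x : ι → ℝ =>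
      stdGaussianPDF x * x k * (m j * B i k + m i * B j k) :=
    fun k _ => (integrable_stdGaussianPDF_mul_apply k).mul_const _
  have i₂ : ∀ k, ∀ l ∈ Finset.univ, Integrable fun x : ι → ℝ =>
      stdGaussianPDF x * (x k * x l) * (B i k * B j l) :=
    fun k l _ => (integrable_stdGaussianPDF_mul_apply_mul_apply k l).mul_const _
  have i₂' : ∀ k ∈ Finset.univ, Integrable fun x : ι → ℝ =>
      ∑ l, stdGaussianPDF x * (x k * x l) * (B i k * B j l) :=
    fun k _ => integrable_finsetSum _ (i₂ k)
  simp only [expand]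
  refine (integral_add i₀ ((integrable_finsetSum _ i₁).add (integrable_finsetSum _ i₂'))).trans ?_
  rw [integral_add' (integrable_finsetSum _ i₁) (integrable_finsetSum _ i₂'),
    integral_finsetSum _ i₁, integral_finsetSum _ i₂']
  simp only [integral_finsetSum _ (i₂ _), integral_mul_const, integral_stdGaussianPDF,
    integral_stdGaussianPDF_mul_apply, integral_stdGaussianPDF_mul_apply_mul_apply]
  simp [one_apply, mul_apply, add_comm]

end StandardGaussian

section Gaussian

variable {ι : Type*} [Fintype ι] [DecidableEq ι]

theorem integral_comp_add_mulVec {B : Matrix ι ι ℝ} (hB : B.det ≠ 0) (m : ι → ℝ)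
    {f : (ι → ℝ) → ℝ} (hf : Continuous f) :
    ∫ x, f (m + B *ᵥ x) = |B.det⁻¹| * ∫ h, f h := by
  have h := integral_map (μ := (volume : Measure (ι → ℝ))) (φ := toLin' B)
    (f := fun y => f (m + y)) (by fun_prop)
    (Continuous.aestronglyMeasurable (by fun_prop))
  rw [Real.map_matrix_volume_pi_eq_smul_volume_pi hB, integral_smul_measure,
    integral_add_left_eq_self f m, ENNReal.toReal_ofReal (abs_nonneg _)] at h
  simpa using h.symm

theorem Matrix.PosDef.exists_mul_transpose_eq_inv {M : Matrix ι ι ℝ} (hM : M.PosDef) :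
    ∃ B : Matrix ι ι ℝ, B.det ≠ 0 ∧ B * Bᵀ = M⁻¹ ∧ Bᵀ * M * B = 1 := by
  open scoped MatrixOrder in
  obtain ⟨a, ha⟩ := CStarAlgebra.nonneg_iff_eq_star_mul_self.mp hM.posSemidef.nonneg
  have ha' : M = aᵀ * a := by simpa [star_eq_conjTranspose] using ha
  have hdet : a.det ≠ 0 := fun h => hM.det_pos.ne' (by simp [ha', h])
  have hu : IsUnit a.det := isUnit_iff_ne_zero.2 hdet
  have hut : IsUnit aᵀ.det := by rwa [det_transpose]
  refine ⟨a⁻¹, ?_, ?_, ?_⟩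
  · simpa [det_nonsing_inv] using hdet
  · rw [ha', mul_inv_rev, transpose_nonsing_inv]
  · rw [ha', transpose_nonsing_inv, ← mul_assoc, nonsing_inv_mul _ hut, one_mul,
      mul_nonsing_inv _ hu]

/-- The second moment of the Gaussian with precision matrix `M` and mean `m`. -/
theorem Matrix.PosDef.gaussian_second_moment {M : Matrix ι ι ℝ} (hM : M.PosDef) (m : ι → ℝ)
    (i j : ι) :
    (∫ h, Real.exp (-(1 / 2) * ((h - m) ⬝ᵥ (M *ᵥ (h - m)))) * (h i * h j)) /
      (∫ h, Real.exp (-(1 / 2) * ((h - m) ⬝ᵥ (M *ᵥ (h - m))))) = M⁻¹ i j + m i * m j := by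
  obtain ⟨B, hdet, hinv, hone⟩ := hM.exists_mul_transpose_eq_inv
  obtain ⟨c, hc, hcexp⟩ := exists_stdGaussianPDF_eq_mul_exp (ι := ι)
  have hquad : ∀ x : ι → ℝ, (B *ᵥ x) ⬝ᵥ (M *ᵥ (B *ᵥ x)) = x ⬝ᵥ x := fun x => by
    rw [dotProduct_comm, dotProduct_mulVec, ← mulVec_transpose, mulVec_mulVec, mulVec_mulVec,
      hone, one_mulVec]
  have hexp : ∀ x : ι → ℝ, Real.exp (-(1 / 2) * (x ⬝ᵥ x)) = c⁻¹ * stdGaussianPDF x := fun x => by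
    rw [hcexp, inv_mul_cancel_left₀ hc.ne']
  have h₀ := integral_comp_add_mulVec hdet m
    (f := fun h => Real.exp (-(1 / 2) * ((h - m) ⬝ᵥ (M *ᵥ (h - m))))) (by fun_prop)
  have h₁ := integral_comp_add_mulVec hdet m
    (f := fun h => Real.exp (-(1 / 2) * ((h - m) ⬝ᵥ (M *ᵥ (h - m)))) * (h i * h j)) (by fun_prop)
  simp only [add_sub_cancel_left, hquad, hexp, mul_assoc, integral_const_mul] at h₀ h₁
  rw [integral_stdGaussianPDF] at h₀
  rw [integral_stdGaussianPDF_mul_affine_mul_affine, hinv] at h₁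
  have hd : |B.det⁻¹| ≠ 0 := by simpa using hdet
  rw [← mul_div_mul_left _ _ hd, ← h₀, ← h₁]
  field_simp

end Gaussian

theorem integrable_apply_mul_apply {ι Ω : Type*} [Fintype ι] [MeasurableSpace Ω] {μ : Measure Ω}
    {X : Ω → ι → ℝ} (hX : Measurable X) (hint : Integrable (fun ω => ‖X ω‖ ^ 2) μ) (i j : ι) :
    Integrable (fun ω => X ω i * X ω j) μ := by
  refine hint.mono' (by fun_prop) (ae_of_all _ fun ω => ?_)
  rw [norm_mul, sq]
  gcongr <;> exact norm_le_pi_norm _ _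

/-- Completing the square in the sum of two quadratic forms. -/
theorem Matrix.exists_add_quadraticForm_eq {ι : Type*} [Fintype ι] [DecidableEq ι]
    {A F : Matrix ι ι ℝ} (hA : A.IsSymm) (hF : F.IsSymm) (hdet : IsUnit (A + F).det) (u : ι → ℝ) :
    ∃ r : ℝ, ∀ h : ι → ℝ, (h - u) ⬝ᵥ (A *ᵥ (h - u)) + h ⬝ᵥ (F *ᵥ h) =
      (h - (A + F)⁻¹ *ᵥ (A *ᵥ u)) ⬝ᵥ ((A + F) *ᵥ (h - (A + F)⁻¹ *ᵥ (A *ᵥ u))) + r := by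
  set m := (A + F)⁻¹ *ᵥ (A *ᵥ u) with hm
  have hMm : (A + F) *ᵥ m = A *ᵥ u := by
    rw [hm, mulVec_mulVec, mul_nonsing_inv _ hdet, one_mulVec]
  have symm : ∀ {Q : Matrix ι ι ℝ}, Q.IsSymm → ∀ x y : ι → ℝ, x ⬝ᵥ (Q *ᵥ y) = y ⬝ᵥ (Q *ᵥ x) :=
    fun {Q} hQ x y => by
      rw [dotProduct_mulVec, ← mulVec_transpose, hQ.eq, dotProduct_comm]
  refine ⟨u ⬝ᵥ (A *ᵥ u) - m ⬝ᵥ (A *ᵥ u), fun h => ?_⟩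
  have h₁ := symm (hA.add hF) m h
  rw [hMm] at h₁
  simp only [mulVec_sub, hMm, dotProduct_sub, sub_dotProduct, h₁, symm hA u h]
  simp only [add_mulVec, dotProduct_add]
  ring

theorem integral_mulVec_apply_mul_mulVec_apply {ι Ω : Type*} [Fintype ι] [MeasurableSpace Ω]
    {μ : Measure Ω} {X : Ω → ι → ℝ} (D S : Matrix ι ι ℝ)
    (hint : ∀ k l, Integrable (fun ω => X ω k * X ω l) μ)
    (hS : ∀ k l, S k l = ∫ ω, X ω k * X ω l ∂μ) (i j : ι) :
    Integrable (fun ω => (D *ᵥ X ω) i * (D *ᵥ X ω) j) μ ∧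
      ∫ ω, (D *ᵥ X ω) i * (D *ᵥ X ω) j ∂μ = (D * S * Dᵀ) i j := by
  have expand : ∀ ω, (D *ᵥ X ω) i * (D *ᵥ X ω) j =
      ∑ l, ∑ k, (X ω k * X ω l) * (D i k * D j l) := fun ω => by
    simp only [mulVec, dotProduct, Finset.sum_mul_sum]
    rw [Finset.sum_comm]
    exact Finset.sum_congr rfl fun k _ => Finset.sum_congr rfl fun l _ => by ring
  have h₂ : ∀ l, ∀ k ∈ Finset.univ, Integrable (fun ω => (X ω k * X ω l) * (D i k * D j l)) μ :=
    fun l k _ => (hint k l).mul_const _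
  have h₁ : ∀ l ∈ Finset.univ, Integrable (fun ω => ∑ k, (X ω k * X ω l) * (D i k * D j l)) μ :=
    fun l _ => integrable_finsetSum _ (h₂ l)
  simp only [expand]
  refine ⟨integrable_finsetSum _ h₁, ?_⟩
  rw [integral_finsetSum _ h₁]
  simp only [integral_finsetSum _ (h₂ _), integral_mul_const, ← hS, mul_apply, transpose_apply,
    Finset.sum_mul]
  exact Finset.sum_congr rfl fun l _ => Finset.sum_congr rfl fun k _ => by ring

/-- Saddle-point equation for the adapted feature kernel of a two-layer linear network
after transfer learning: the averaged conditional second moment of the preactivations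
equals `M⁻¹ + δ² M⁻¹ C⁻¹ S C⁻¹ M⁻¹`, where `M = (1+δ) C⁻¹ + Φ̂` and `S = E[h̄ h̄ᵀ]`. -/
theorem stmt4 (P : ℕ) (hP : 0 < P)
    (C : Matrix (Fin P) (Fin P) ℝ) (hC : C.PosDef)
    (Φhat : Matrix (Fin P) (Fin P) ℝ) (hΦhat : Φhat.IsSymm)
    (δ : ℝ) (hδ : 0 ≤ δ)
    (hM : ((1 + δ) • C⁻¹ + Φhat).PosDef)
    {Ω : Type*} [MeasureSpace Ω] [IsProbabilityMeasure (volume : Measure Ω)]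
    (hbar : Ω → (Fin P → ℝ)) (hmeas : Measurable hbar)
    (hint : Integrable (fun ω => ‖hbar ω‖ ^ 2))
    (S : Matrix (Fin P) (Fin P) ℝ)
    (hS : ∀ i j, S i j = ∫ ω, hbar ω i * hbar ω j) :
    let M := (1 + δ) • C⁻¹ + Φhat
    let q : (Fin P → ℝ) → (Fin P → ℝ) → ℝ := fun hb h =>
      Real.exp (-((1 + δ) / 2) *
          ((h - (δ / (1 + δ)) • hb) ⬝ᵥ (C⁻¹ *ᵥ (h - (δ / (1 + δ)) • hb)))
        - (1 / 2) * (h ⬝ᵥ (Φhat *ᵥ h)))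
    ∀ i j, (∫ ω, (∫ h, q (hbar ω) h * (h i * h j)) / (∫ h, q (hbar ω) h)) =
      (M⁻¹ + δ ^ 2 • (M⁻¹ * C⁻¹ * S * C⁻¹ * M⁻¹)) i j := by
  intro M q i j
  have hδ₁ : 1 + δ ≠ 0 := by positivity
  have hCs : (C⁻¹).IsSymm := by simpa [IsSymm, IsHermitian] using hC.inv.isHermitian
  have hMs : M.IsSymm := (hCs.smul (1 + δ)).add hΦhat
  have hMinv : (M⁻¹)ᵀ = M⁻¹ := by rw [transpose_nonsing_inv, hMs.eq]
  set D : Matrix (Fin P) (Fin P) ℝ := δ • (M⁻¹ * C⁻¹) with hD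
  have hcond : ∀ ω, (∫ h, q (hbar ω) h * (h i * h j)) / (∫ h, q (hbar ω) h) =
      M⁻¹ i j + (D *ᵥ hbar ω) i * (D *ᵥ hbar ω) j := fun ω => by
    obtain ⟨r, hr⟩ := exists_add_quadraticForm_eq (hCs.smul (1 + δ)) hΦhat
      hM.det_pos.ne'.isUnit ((δ / (1 + δ)) • hbar ω)
    have hmean : M⁻¹ *ᵥ (((1 + δ) • C⁻¹) *ᵥ ((δ / (1 + δ)) • hbar ω)) = D *ᵥ hbar ω := by
      simp only [hD, smul_mulVec, mulVec_smul, mulVec_mulVec, smul_smul]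
      rw [div_mul_cancel₀ _ hδ₁]
    rw [hmean] at hr
    have hq : ∀ h, q (hbar ω) h = Real.exp (-(1 / 2) * r) *
        Real.exp (-(1 / 2) * ((h - D *ᵥ hbar ω) ⬝ᵥ (M *ᵥ (h - D *ᵥ hbar ω)))) := fun h => by
      have := hr h
      rw [smul_mulVec, dotProduct_smul, smul_eq_mul] at this
      rw [← Real.exp_add]
      refine congrArg Real.exp ?_
      linear_combination (-(1 / 2)) * this
    simp only [hq, mul_assoc, integral_const_mul]
    rw [mul_div_mul_left _ _ (Real.exp_ne_zero _)]
    exact hM.gaussian_second_moment _ i j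
  obtain ⟨hDint, hDval⟩ := integral_mulVec_apply_mul_mulVec_apply D S
    (integrable_apply_mul_apply hmeas hint) hS i j
  simp only [hcond]
  rw [integral_add (integrable_const _) hDint, hDval, Matrix.add_apply]
  congr 1
  · simp
  · rw [hD, transpose_smul, transpose_mul, hCs.eq, hMinv]
    simp only [smul_mul, Matrix.mul_smul, smul_smul, ← mul_assoc, sq]
end

section
/- Let β > 0, γ₀ > 0 and φ̄ ∈ ℝ. Suppose φ : (0, ∞) → [0, ∞) is a function such that, for every δ > γ₀² β², setting φ̂(δ) = −γ₀² (β⁻¹ + φ(δ))⁻², one has 1 + δ + φ̂(δ) > 0 and φ(δ) = (1 + δ + φ̂(δ))⁻¹ + δ² φ̄ (1 + δ + φ̂(δ))⁻². Then φ(δ) → φ̄ as δ → ∞. -/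
open Filter

/-- If `a δ / δ → 0`, then `δ / (1 + δ + a δ) → 1`. -/
theorem tendsto_mul_inv_one_add_add {a : ℝ → ℝ}
    (ha : Tendsto (fun δ => a δ * δ⁻¹) atTop (nhds 0)) :
    Tendsto (fun δ => δ * (1 + δ + a δ)⁻¹) atTop (nhds 1) := by
  have h : Tendsto (fun δ : ℝ => (δ⁻¹ + 1 + a δ * δ⁻¹)⁻¹) atTop (nhds 1) := by
    simpa using ((tendsto_inv_atTop_zero.add_const (1 : ℝ)).add ha).inv₀ (by norm_num)
  refine h.congr' ?_
  filter_upwards [eventually_gt_atTop 0] with δ hδ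
  have : δ⁻¹ + 1 + a δ * δ⁻¹ = δ⁻¹ * (1 + δ + a δ) := by field_simp
  rw [this, mul_inv, inv_inv]

/-- As the elastic coupling `δ → ∞`, the target label overlap `φ(δ)` determined by the
self-consistent saddle-point equations converges to the source overlap `φ̄`. -/
theorem stmt11 (β γ₀ φbar : ℝ) (hβ : 0 < β) (hγ : 0 < γ₀)
    (φ : ℝ → ℝ) (hφnonneg : ∀ δ, 0 < δ → 0 ≤ φ δ)
    (hfix : ∀ δ, γ₀ ^ 2 * β ^ 2 < δ →
      0 < 1 + δ + (-γ₀ ^ 2 * ((β⁻¹ + φ δ)⁻¹) ^ 2) ∧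
      φ δ = (1 + δ + (-γ₀ ^ 2 * ((β⁻¹ + φ δ)⁻¹) ^ 2))⁻¹ +
        δ ^ 2 * φbar * ((1 + δ + (-γ₀ ^ 2 * ((β⁻¹ + φ δ)⁻¹) ^ 2))⁻¹) ^ 2) :
    Tendsto φ atTop (nhds φbar) := by
  set a : ℝ → ℝ := fun δ => -γ₀ ^ 2 * ((β⁻¹ + φ δ)⁻¹) ^ 2 with ha
  have ha0 : Tendsto (fun δ => a δ * δ⁻¹) atTop (nhds 0) := by
    refine squeeze_zero_norm' (a := fun δ => γ₀ ^ 2 * β ^ 2 * δ⁻¹) ?_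
      (by simpa using tendsto_inv_atTop_zero.const_mul (γ₀ ^ 2 * β ^ 2))
    filter_upwards [eventually_gt_atTop 0] with δ hδ
    have hφ := hφnonneg δ hδ
    have hle : (β⁻¹ + φ δ)⁻¹ ≤ β :=
      inv_le_of_inv_le₀ hβ (le_add_of_nonneg_right hφ)
    have hnorm : ‖a δ * δ⁻¹‖ = γ₀ ^ 2 * ((β⁻¹ + φ δ)⁻¹) ^ 2 * δ⁻¹ := by
      simp only [ha]
      rw [neg_mul, neg_mul, norm_neg, Real.norm_of_nonneg (by positivity)]
    rw [hnorm]
    gcongr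
  have hr := tendsto_mul_inv_one_add_add ha0
  have hlim : Tendsto (fun δ => δ⁻¹ * (δ * (1 + δ + a δ)⁻¹) +
      φbar * (δ * (1 + δ + a δ)⁻¹) ^ 2) atTop (nhds φbar) := by
    simpa using (tendsto_inv_atTop_zero.mul hr).add ((hr.pow 2).const_mul φbar)
  refine hlim.congr' ?_
  filter_upwards [eventually_gt_atTop 0, eventually_gt_atTop (γ₀ ^ 2 * β ^ 2)] with δ hδ hδ'
  have h : φ δ = (1 + δ + a δ)⁻¹ + δ ^ 2 * φbar * ((1 + δ + a δ)⁻¹) ^ 2 := (hfix δ hδ').2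
  rw [h, inv_mul_cancel_left₀ hδ.ne']
  ring
end

section
/- Let N, P be positive integers, λ ∈ ℝ, γ₀ ≠ 0, let (C_{μν}) be a real P×P matrix, let Δ_μ : [0, ∞) → ℝ be continuous for μ = 1, …, P, and let φ : ℝ → ℝ be differentiable with h φ′(h) = φ(h) for all h ∈ ℝ. Suppose h_{iμ}, z_i : [0, ∞) → ℝ (for i = 1, …, N, μ = 1, …, P) are differentiable and satisfy z_i′(t) = −λ z_i(t) + γ₀ Σ_{μ} Δ_μ(t) φ(h_{iμ}(t)) and h_{iμ}′(t) = −λ h_{iμ}(t) + γ₀ Σ_{ν} Δ_ν(t) g_{iν}(t) C_{μν}, where g_{iν}(t) := φ′(h_{iν}(t)) z_i(t). Define f_μ(t) = (1/(γ₀ N)) Σ_i z_i(t) φ(h_{iμ}(t)), Φ_{μν}(t) = (1/N) Σ_i φ(h_{iμ}(t)) φ(h_{iν}(t)), and G_{μν}(t) = (1/N) Σ_i g_{iμ}(t) g_{iν}(t). Then f_μ′(t) = Σ_{ν} (Φ_{μν}(t) + C_{μν} G_{μν}(t)) Δ_ν(t) − 2λ f_μ(t) for all t ≥ 0 and all μ.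 -/
open Matrix

/-- Finite-width predictor dynamics of a two-layer network under gradient flow with
weight decay (δ = 0) and a degree-one positively homogeneous activation:
`f_μ′ = Σ_ν (Φ_{μν} + C_{μν} G_{μν}) Δ_ν − 2λ f_μ`. -/
theorem stmt16 (N P : ℕ) (hN : 0 < N) (hP : 0 < P) (lam γ₀ : ℝ) (hγ : γ₀ ≠ 0)
    (C : Matrix (Fin P) (Fin P) ℝ)
    (Δ : Fin P → ℝ → ℝ) (hΔ : ∀ μ, ContinuousOn (Δ μ) (Set.Ici 0))
    (φ : ℝ → ℝ) (hφdiff : Differentiable ℝ φ)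
    (hφhom : ∀ v : ℝ, v * deriv φ v = φ v)
    (h : Fin N → Fin P → ℝ → ℝ) (z : Fin N → ℝ → ℝ)
    (hz : ∀ i, ∀ t ∈ Set.Ici (0 : ℝ), HasDerivWithinAt (z i)
      (-lam * z i t + γ₀ * ∑ μ, Δ μ t * φ (h i μ t)) (Set.Ici 0) t)
    (hh : ∀ i μ, ∀ t ∈ Set.Ici (0 : ℝ), HasDerivWithinAt (h i μ)
      (-lam * h i μ t + γ₀ * ∑ ν, Δ ν t * (deriv φ (h i ν t) * z i t) * C μ ν)
      (Set.Ici 0) t) :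
    let f : Fin P → ℝ → ℝ := fun μ t => (1 / (γ₀ * N)) * ∑ i, z i t * φ (h i μ t)
    let Φ : Fin P → Fin P → ℝ → ℝ := fun μ ν t =>
      (1 / (N : ℝ)) * ∑ i, φ (h i μ t) * φ (h i ν t)
    let G : Fin P → Fin P → ℝ → ℝ := fun μ ν t =>
      (1 / (N : ℝ)) * ∑ i, (deriv φ (h i μ t) * z i t) * (deriv φ (h i ν t) * z i t)
    ∀ μ, ∀ t ∈ Set.Ici (0 : ℝ), HasDerivWithinAt (f μ)
      ((∑ ν, (Φ μ ν t + C μ ν * G μ ν t) * Δ ν t) - 2 * lam * f μ t)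
      (Set.Ici 0) t := by
  intro f Φ G μ t ht
  have key : ∀ i, HasDerivWithinAt (fun s => z i s * φ (h i μ s))
      (γ₀ * (∑ ν, (φ (h i μ t) * φ (h i ν t) + C μ ν *
        ((deriv φ (h i μ t) * z i t) * (deriv φ (h i ν t) * z i t))) * Δ ν t)
        - 2 * lam * (z i t * φ (h i μ t))) (Set.Ici 0) t := by
    intro i
    refine ((hz i t ht).mul
      ((hφdiff (h i μ t)).hasDerivAt.comp_hasDerivWithinAt t (hh i μ t ht))).congr_deriv ?_
    have hsum : ∑ ν, (φ (h i μ t) * φ (h i ν t) + C μ ν *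
        ((deriv φ (h i μ t) * z i t) * (deriv φ (h i ν t) * z i t))) * Δ ν t
        = φ (h i μ t) * ∑ ν, Δ ν t * φ (h i ν t) + deriv φ (h i μ t) * z i t *
          ∑ ν, Δ ν t * (deriv φ (h i ν t) * z i t) * C μ ν := by
      rw [Finset.mul_sum, Finset.mul_sum, ← Finset.sum_add_distrib]
      exact Finset.sum_congr rfl fun ν _ => by ring
    rw [hsum, Function.comp_apply]
    linear_combination (-lam * z i t) * hφhom (h i μ t)
  refine ((HasDerivWithinAt.fun_sum fun i (_ : i ∈ Finset.univ) => key i).const_mul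
    (1 / (γ₀ * N))).congr_deriv ?_
  have hkernels : ∑ ν, (Φ μ ν t + C μ ν * G μ ν t) * Δ ν t = (1 / (N : ℝ)) *
      ∑ i, ∑ ν, (φ (h i μ t) * φ (h i ν t) + C μ ν *
        ((deriv φ (h i μ t) * z i t) * (deriv φ (h i ν t) * z i t))) * Δ ν t := by
    rw [Finset.sum_comm, Finset.mul_sum]
    refine Finset.sum_congr rfl fun ν _ => ?_
    rw [← Finset.sum_mul, Finset.sum_add_distrib, ← Finset.mul_sum]
    ring
  have hN' : (N : ℝ) ≠ 0 := Nat.cast_ne_zero.mpr hN.ne'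
  rw [hkernels, Finset.sum_sub_distrib, ← Finset.mul_sum, ← Finset.mul_sum]
  simp only [f]
  field_simp
end
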